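/- arXiv:2407.08904 — 2 statements merged into one kernel-verified Lean document; each statement's English description precedes it below -/
import Mathlib

section
/- Let M be an R-proximally smooth closed set. Then for any point x ∈ M, any proximal normal vector v to M at x, and any y ∈ M, the inequality ⟨v, y − x⟩ ≤ (‖v‖/(2R))‖y − x‖² holds. -/
open scoped RealInnerProductSpace
open Filter Topology Metric

section DistanceAscent

variable {E : Type*} [NormedAddCommGroup E] [InnerProductSpace ℝ E] [ProperSpace E]

/-- At a point off `M` with a unique nearest point in `M`, the distance to `M` has slope at
least `c` in some arbitrarily short direction, for every `c < 1`. -/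
theorem exists_infDist_add_gt {M : Set E} (hM : IsClosed M) (hne : M.Nonempty) {w p : E}
    (hp : ∀ y ∈ M, dist y w = infDist w M → y = p) (hd : 0 < infDist w M)
    {c ρ : ℝ} (hc : c < 1) (hρ : 0 < ρ) :
    ∃ h : E, ‖h‖ < ρ ∧ infDist w M + c * ‖h‖ < infDist (w + h) M := by
  by_contra! H
  obtain ⟨q₀, hq₀M, hq₀⟩ := hM.exists_infDist_eq_dist hne w
  obtain rfl : q₀ = p := hp q₀ hq₀M (by rw [dist_comm, hq₀])
  set d := infDist w M with hd_def
  have hnorm : ‖w - q₀‖ = d := by rw [hq₀, dist_eq_norm]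
  set n : E := d⁻¹ • (w - q₀) with hn_def
  have hn : ‖n‖ = 1 := by
    rw [hn_def, norm_smul, hnorm, Real.norm_of_nonneg (inv_nonneg.2 hd.le),
      inv_mul_cancel₀ hd.ne']
  have hnw : ⟪n, w - q₀⟫ = d := by
    rw [hn_def, real_inner_smul_left, real_inner_self_eq_norm_sq, hnorm]
    field_simp
  obtain ⟨t, -, ht, htlim⟩ := exists_seq_strictAnti_tendsto' hρ
  have hproj (k : ℕ) : ∃ q ∈ M, infDist (w + t k • n) M = dist (w + t k • n) q :=
    hM.exists_infDist_eq_dist hne _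
  choose q hqM hq using hproj
  have hlim : Tendsto (fun k => w + t k • n) atTop (𝓝 w) := by
    simpa using (htlim.smul_const n).const_add w
  have hdlim : Tendsto (fun k => infDist (w + t k • n) M) atTop (𝓝 d) :=
    (continuous_infDist_pt M).continuousAt.tendsto.comp hlim
  have htn (k : ℕ) : ‖t k • n‖ = t k := by
    rw [norm_smul, hn, mul_one, Real.norm_of_nonneg (ht k).1.le]
  have hqball (k : ℕ) : q k ∈ closedBall w (d + 2 * ρ) := by
    have h1 : infDist (w + t k • n) M ≤ d + dist (w + t k • n) w := infDist_le_infDist_add_dist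
    have h2 := dist_triangle (q k) (w + t k • n) w
    rw [dist_comm (q k) (w + t k • n), ← hq k] at h2
    have h3 : dist (w + t k • n) w = t k := by rw [dist_eq_norm, add_sub_cancel_left, htn]
    rw [mem_closedBall]
    linarith [(ht k).2]
  obtain ⟨q', -, φ, hφ, hφlim⟩ := (isCompact_closedBall w (d + 2 * ρ)).tendsto_subseq hqball
  have hq'M : q' ∈ M := hM.mem_of_tendsto hφlim (Eventually.of_forall fun k => hqM _)
  have hq'd : dist q' w = d := by
    rw [dist_comm]
    refine tendsto_nhds_unique ((hlim.comp hφ.tendsto_atTop).dist hφlim) ?_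
    exact (hdlim.comp hφ.tendsto_atTop).congr fun k => hq (φ k)
  obtain rfl : q' = q₀ := hp q' hq'M hq'd
  have key (k : ℕ) : 2 * ⟪n, w - q k⟫ + t k ≤ 2 * d * c + t k * c ^ 2 := by
    have h1 := H (t k • n) (by rw [htn]; exact (ht k).2)
    rw [htn] at h1
    have h2 : infDist (w + t k • n) M ^ 2 = ‖w - q k‖ ^ 2 + 2 * t k * ⟪n, w - q k⟫ + t k ^ 2 := by
      rw [hq, dist_eq_norm, show w + t k • n - q k = (w - q k) + t k • n by abel,
        norm_add_sq_real, htn, real_inner_smul_right, real_inner_comm]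
      ring
    have h3 : d ≤ ‖w - q k‖ := by rw [← dist_eq_norm]; exact infDist_le_dist_of_mem (hqM k)
    have h4 : infDist (w + t k • n) M ^ 2 ≤ (d + c * t k) ^ 2 :=
      pow_le_pow_left₀ infDist_nonneg h1 2
    have h5 : d ^ 2 ≤ ‖w - q k‖ ^ 2 := pow_le_pow_left₀ hd.le h3 2
    refine le_of_mul_le_mul_left ?_ (ht k).1
    nlinarith
  have htφ := htlim.comp hφ.tendsto_atTop
  have hl : Tendsto (fun k => 2 * ⟪n, w - q (φ k)⟫ + t (φ k)) atTop
      (𝓝 (2 * ⟪n, w - q'⟫ + 0)) :=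
    ((tendsto_const_nhds.inner (hφlim.const_sub w)).const_mul 2).add htφ
  have hr : Tendsto (fun k => 2 * d * c + t (φ k) * c ^ 2) atTop
      (𝓝 (2 * d * c + 0 * c ^ 2)) :=
    (htφ.mul_const (c ^ 2)).const_add (2 * d * c)
  have hle := le_of_tendsto_of_tendsto' hl hr fun k => key (φ k)
  rw [hnw] at hle
  nlinarith

/-- If nearest points in `M` are unique at all points at distance less than `R`, then from any
such point off `M` the distance to `M` can be raised at unit speed up to the value `R`. -/
theorem exists_dist_le_infDist_eq_add {M : Set E} (hM : IsClosed M) (hne : M.Nonempty) {R : ℝ}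
    (huniq : ∀ w, infDist w M < R → ∃ p, ∀ y ∈ M, dist y w = infDist w M → y = p)
    {z : E} {s : ℝ} (hz : 0 < infDist z M) (hs : 0 ≤ s) (hsR : infDist z M + s < R) :
    ∃ w, dist w z ≤ s ∧ infDist z M + s ≤ infDist w M := by
  have hball : (closedBall z s).Nonempty := ⟨z, mem_closedBall_self hs⟩
  obtain ⟨w, hw, hmax⟩ := (isCompact_closedBall z s).exists_isMaxOn hball
    (continuous_infDist_pt M).continuousOn
  refine ⟨w, hw, ?_⟩
  have hslope (c : ℝ) (hc0 : 0 < c) (hc : c < 1) : infDist z M + c * s ≤ infDist w M := by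
    obtain ⟨u, hu, humax⟩ := (isCompact_closedBall z s).exists_isMaxOn hball
      (f := fun u => infDist u M - c * dist u z) (by fun_prop)
    have hzu := humax (mem_closedBall_self hs)
    simp only [Set.mem_ofPred_eq, dist_self, mul_zero, sub_zero] at hzu
    have hus : dist u z = s := by
      by_contra hne_s
      have hlt : dist u z < s := lt_of_le_of_ne hu hne_s
      have hpos : 0 < infDist u M := by nlinarith [dist_nonneg (x := u) (y := z)]
      have hlip : infDist u M ≤ infDist z M + dist u z := infDist_le_infDist_add_dist
      obtain ⟨p, hp⟩ := huniq u (by linarith)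
      obtain ⟨h, hh, hgt⟩ := exists_infDist_add_gt hM hne hp hpos hc (sub_pos.2 hlt)
      have htri : dist (u + h) z ≤ ‖h‖ + dist u z := by
        simpa [dist_eq_norm] using dist_triangle (u + h) u z
      have hle := humax (show u + h ∈ closedBall z s by rw [mem_closedBall]; linarith)
      simp only [Set.mem_ofPred_eq] at hle
      nlinarith
    have hwu := hmax hu
    simp only [Set.mem_ofPred_eq] at hwu
    rw [hus] at hzu
    linarith
  have hlim : Tendsto (fun c : ℝ => infDist z M + c * s) (𝓝[<] 1) (𝓝 (infDist z M + 1 * s)) :=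
    ((tendsto_nhdsWithin_of_tendsto_nhds tendsto_id).mul_const s).const_add _
  rw [one_mul] at hlim
  refine le_of_tendsto hlim ?_
  filter_upwards [Ioo_mem_nhdsLT (zero_lt_one' ℝ)] with c hc
  exact hslope c hc.1 hc.2

/-- If nearest points in `M` are unique at all points at distance less than `R`, then a ray that
leaves `M` at `x` and has `x` as nearest point at one parameter keeps `x` as nearest point up to
distance `R`. -/
theorem infDist_add_smul_eq {M : Set E} (hM : IsClosed M) {R : ℝ}
    (huniq : ∀ w, infDist w M < R → ∃ p, ∀ y ∈ M, dist y w = infDist w M → y = p)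
    {x u : E} (hx : x ∈ M) (hu : ‖u‖ = 1) {a r : ℝ} (ha : 0 < a) (har : a ≤ r) (hrR : r < R)
    (hdist : infDist (x + a • u) M = a) : infDist (x + r • u) M = r := by
  obtain ⟨w, hwz, hw⟩ := exists_dist_le_infDist_eq_add hM ⟨x, hx⟩ huniq (z := x + a • u)
    (s := r - a) (by rwa [hdist]) (by linarith) (by linarith)
  have hr : 0 < r := ha.trans_le har
  have hxz : dist x (x + a • u) = a := by
    simp [dist_eq_norm, norm_smul, hu, abs_of_pos ha]
  have hwx : infDist w M ≤ dist w x := infDist_le_dist_of_mem hx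
  have htri := dist_triangle x (x + a • u) w
  rw [dist_comm w x] at hwx
  rw [dist_comm w] at hwz
  have hxw : dist x w = r := by linarith
  have hline : x + a • u = AffineMap.lineMap x w (a / r) := by
    apply eq_lineMap_of_dist_eq_mul_of_dist_eq_mul
    · rw [hxz, hxw]; field_simp
    · rw [hxw, sub_mul, div_mul_cancel₀ _ hr.ne']; linarith
  have hwu : w = x + r • u := by
    rw [AffineMap.lineMap_apply, vsub_eq_sub, vadd_eq_add, add_comm _ x] at hline
    have h := congrArg (fun b => (r / a) • b) (add_left_cancel hline)
    simp only [smul_smul] at h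
    rw [div_mul_cancel₀ _ ha.ne', div_mul_div_cancel₀ ha.ne', div_self hr.ne', one_smul] at h
    rw [h, add_sub_cancel]
  rw [← hwu]
  linarith

end DistanceAscent

/-- Let `M` be an `R`-proximally smooth closed set. Then for any point
`x ∈ M`, any proximal normal vector `v` to `M` at `x` (i.e. `P (x + t • v) = x` for all
sufficiently small `t > 0`), and any `y ∈ M`, we have
`⟪v, y - x⟫ ≤ (‖v‖ / (2R)) * ‖y - x‖²`. -/
theorem stmt1 {N : ℕ} (M : Set (EuclideanSpace ℝ (Fin N))) (hMclosed : IsClosed M)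
    (hMne : M.Nonempty) (R : ℝ) (hR : 0 < R)
    (P : EuclideanSpace ℝ (Fin N) → EuclideanSpace ℝ (Fin N))
    (hP : ∀ x, Metric.infDist x M < R →
      P x ∈ M ∧ dist (P x) x = Metric.infDist x M ∧
        ∀ y ∈ M, dist y x = Metric.infDist x M → y = P x)
    (x : EuclideanSpace ℝ (Fin N)) (hx : x ∈ M)
    (v : EuclideanSpace ℝ (Fin N))
    (hv : ∃ t₀ : ℝ, 0 < t₀ ∧ ∀ t : ℝ, 0 < t → t ≤ t₀ → P (x + t • v) = x) :
    ∀ y ∈ M, ⟪v, y - x⟫ ≤ (‖v‖ / (2 * R)) * ‖y - x‖ ^ 2 := by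
  intro y hy
  rcases eq_or_ne v 0 with rfl | hv0
  · simp
  have hvn : 0 < ‖v‖ := norm_pos_iff.2 hv0
  obtain ⟨t₀, ht₀, hPt⟩ := hv
  set u := ‖v‖⁻¹ • v with hu_def
  have hu : ‖u‖ = 1 := by
    rw [hu_def, norm_smul, norm_inv, norm_norm, inv_mul_cancel₀ hvn.ne']
  have hvu : v = ‖v‖ • u := by rw [hu_def, smul_inv_smul₀ hvn.ne']
  obtain ⟨a, ha, haR, hat⟩ : ∃ a, 0 < a ∧ a < R ∧ a ≤ t₀ * ‖v‖ :=
    ⟨min (R / 2) (t₀ * ‖v‖), by positivity, (min_le_left _ _).trans_lt (by linarith),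
      min_le_right _ _⟩
  have hxa : dist x (x + a • u) = a := by
    simp [dist_eq_norm, norm_smul, hu, abs_of_pos ha]
  have hdist : infDist (x + a • u) M = a := by
    have hlt : infDist (x + a • u) M < R := by
      have h := infDist_le_dist_of_mem (x := x + a • u) hx
      rw [dist_comm, hxa] at h
      linarith
    have hproj := hPt (a / ‖v‖) (by positivity) ((div_le_iff₀ hvn).2 hat)
    rw [show (a / ‖v‖) • v = a • u by rw [hu_def, smul_smul, div_eq_mul_inv]] at hproj
    rw [← (hP _ hlt).2.1, hproj, hxa]
  have hstep (r : ℝ) (har : a ≤ r) (hrR : r < R) : 2 * r * ⟪u, y - x⟫ ≤ ‖y - x‖ ^ 2 := by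
    have hr : 0 < r := ha.trans_le har
    have hd := infDist_add_smul_eq hMclosed (fun w hw => ⟨P w, (hP w hw).2.2⟩) hx hu ha har hrR
      hdist
    have hle := infDist_le_dist_of_mem (x := x + r • u) hy
    rw [hd, dist_comm, dist_eq_norm, ← sub_sub] at hle
    have hsq := pow_le_pow_left₀ hr.le hle 2
    rw [norm_sub_sq_real, norm_smul, hu, real_inner_smul_right, real_inner_comm, mul_one,
      Real.norm_eq_abs, sq_abs] at hsq
    linarith
  have hlim : Tendsto (fun r : ℝ => 2 * r * ⟪u, y - x⟫) (𝓝[<] R) (𝓝 (2 * R * ⟪u, y - x⟫)) :=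
    tendsto_nhdsWithin_of_tendsto_nhds (Continuous.tendsto (by fun_prop) R)
  have hfin : 2 * R * ⟪u, y - x⟫ ≤ ‖y - x‖ ^ 2 := by
    refine le_of_tendsto hlim ?_
    filter_upwards [Ioo_mem_nhdsLT haR] with r hr
    exact hstep r hr.1.le hr.2
  have hscale : ⟪v, y - x⟫ = ‖v‖ * ⟪u, y - x⟫ := by
    conv_lhs => rw [hvu, real_inner_smul_left]
  rw [hscale, div_mul_eq_mul_div, le_div_iff₀ (by positivity)]
  nlinarith
end

section
/- Single-step consensus stays in neighborhood (projected gradient): Let M be an R-proximally smooth compact submanifold of ℝ^{d×r}, W symmetric doubly stochastic with second largest singular value σ₂ < 1, γ ∈ (0,1]. Consider the iteration x_{i,k+1} = P_M((1−γ)x_{i,k} + γ ∑_j W_{ij} x_{j,k} + η d_{i,k}). If the initial stacked iterate satisfies ‖x_0 − x̄_0‖ ≤ δ with δ < min{Rγ(1−σ₂), R/4}, and the perturbations satisfy ‖η d_k‖ ≤ min{R/4, δ(Rγ(1−σ₂) − δ)/(2(R−δ))} at every step, then ‖x_k − x̄_k‖ ≤ δ for all k ≥ 0, where x̄_k is the n-fold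 copy of P_M of the Euclidean average of the x_{i,k}. -/
open scoped BigOperators

/-- Frobenius norm of a stacked family of vectors. -/
noncomputable def stackNorm {n N : ℕ} (z : Fin n → EuclideanSpace ℝ (Fin N)) : ℝ :=
  Real.sqrt (∑ i, ‖z i‖ ^ 2)

section NearestPoint

variable {E : Type*} [NormedAddCommGroup E] [InnerProductSpace ℝ E]

/-- Every point of the open `R`-tube around `M` has `P z` as its unique nearest point in `M`. -/
def IsUniqueProjection (M : Set E) (R : ℝ) (P : E → E) : Prop :=
  ∀ z, Metric.infDist z M < R →
    P z ∈ M ∧ dist (P z) z = Metric.infDist z M ∧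
      ∀ y ∈ M, dist y z = Metric.infDist z M → y = P z

variable {M : Set E} {R : ℝ} {P : E → E}

/-- The distance to `M` increases at a rate arbitrarily close to one along the outward normal. -/
lemma IsUniqueProjection.exists_infDist_lt (hP : IsUniqueProjection M R P) (hM : IsCompact M)
    {w : E} (hw0 : 0 < Metric.infDist w M) (hwR : Metric.infDist w M < R)
    {ε : ℝ} (hε0 : 0 < ε) (hε1 : ε < 1) {ρ : ℝ} (hρ : 0 < ρ) :
    ∃ z, dist z w < ρ ∧
      Metric.infDist w M + (1 - ε) * dist z w < Metric.infDist z M := by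
  obtain ⟨hpM, hpd, hpu⟩ := hP w hwR
  set f := Metric.infDist w M with hf
  set p := P w with hp
  have hnp : ‖w - p‖ = f := by rw [← dist_eq_norm, dist_comm, hpd]
  set u : E := f⁻¹ • (w - p) with hu
  have hun : ‖u‖ = 1 := by
    rw [hu, norm_smul, hnp, Real.norm_eq_abs, abs_of_pos (inv_pos.2 hw0)]
    field_simp
  have hup : inner ℝ u (w - p) = f := by
    rw [hu, real_inner_smul_left, real_inner_self_eq_norm_sq, hnp]
    field_simp
  let K : Set E := M ∩ {y | inner ℝ u (w - y) ≤ (1 - ε) * f}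
  have hK : IsCompact K :=
    hM.inter_right (isClosed_le (by fun_prop) continuous_const)
  have hgap : ∃ m, f < m ∧ ∀ y ∈ K, m ≤ dist y w := by
    rcases K.eq_empty_or_nonempty with h | h
    · exact ⟨f + 1, by linarith, by simp [h]⟩
    · obtain ⟨y, hy, hyd⟩ := hK.exists_infDist_eq_dist h w
      refine ⟨Metric.infDist w K, ?_, fun z hz => by
        rw [dist_comm]; exact Metric.infDist_le_dist_of_mem hz⟩
      have hle : f ≤ dist w y := Metric.infDist_le_dist_of_mem hy.1
      rw [hyd]
      refine lt_of_le_of_ne hle fun he => ?_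
      have hyp := hpu y hy.1 (by rw [dist_comm, ← he])
      have h2 := hy.2
      simp only [Set.mem_ofPred_eq, hyp, hup] at h2
      nlinarith
  obtain ⟨m, hfm, hm⟩ := hgap
  obtain ⟨t, ht0, htρ⟩ : ∃ t, 0 < t ∧ t < min ρ (min (R - f) ((m - f) / 2)) :=
    exists_between (by
      refine lt_min hρ (lt_min ?_ ?_) <;> linarith)
  obtain ⟨ht1, ht⟩ := lt_min_iff.1 htρ
  obtain ⟨ht2, ht3⟩ := lt_min_iff.1 ht
  have hdz : dist (w + t • u) w = t := by
    rw [dist_eq_norm, add_sub_cancel_left, norm_smul, hun, Real.norm_eq_abs, abs_of_pos ht0,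
      mul_one]
  have hlip : Metric.infDist (w + t • u) M ≤ f + t := by
    have := Metric.infDist_le_infDist_add_dist (s := M) (x := w + t • u) (y := w)
    rwa [hdz] at this
  obtain ⟨hqM, hqd, -⟩ := hP (w + t • u) (by linarith)
  set q := P (w + t • u) with hq
  have hqw : dist q w < m := by
    have := dist_triangle q (w + t • u) w
    linarith
  have hqK : (1 - ε) * f < inner ℝ u (w - q) := by
    by_contra! h
    linarith [hm q ⟨hqM, h⟩]
  have hfq : f ≤ ‖w - q‖ := by
    rw [← dist_eq_norm]; exact Metric.infDist_le_dist_of_mem hqM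
  refine ⟨w + t • u, by linarith, ?_⟩
  rw [hdz, ← hqd, dist_comm, dist_eq_norm]
  have hsq : ‖w + t • u - q‖ ^ 2 = ‖w - q‖ ^ 2 + 2 * t * inner ℝ u (w - q) + t ^ 2 := by
    rw [show w + t • u - q = (w - q) + t • u by abel, norm_add_sq_real, real_inner_smul_right,
      real_inner_comm, norm_smul, hun, Real.norm_eq_abs, abs_of_pos ht0]
    ring
  refine lt_of_pow_lt_pow_left₀ 2 (norm_nonneg _) ?_
  rw [hsq]
  have h1 : t * ((1 - ε) * f) < t * inner ℝ u (w - q) := mul_lt_mul_of_pos_left hqK ht0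
  have h2 : f ^ 2 ≤ ‖w - q‖ ^ 2 := by gcongr
  have h3 : ((1 - ε) * t) ^ 2 ≤ t ^ 2 := by
    have : (1 - ε) * t ≤ t := by nlinarith
    have h0 : 0 ≤ (1 - ε) * t := mul_nonneg (by linarith) ht0.le
    gcongr
  nlinarith

variable [ProperSpace E]

/-- The distance to `M` reaches `infDist v M + r` on the sphere of radius `r` about `v`. -/
lemma IsUniqueProjection.exists_infDist_eq_add (hP : IsUniqueProjection M R P) (hM : IsCompact M)
    {v : E} (hv0 : 0 < Metric.infDist v M) {r : ℝ} (hr0 : 0 ≤ r)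
    (hr : Metric.infDist v M + r < R) :
    ∃ z, dist z v ≤ r ∧ Metric.infDist v M + r ≤ Metric.infDist z M := by
  have hne : (Metric.closedBall v r).Nonempty := ⟨v, Metric.mem_closedBall_self hr0⟩
  have hc : IsCompact (Metric.closedBall v r) := isCompact_closedBall v r
  have hfc : Continuous fun z : E => Metric.infDist z M := Metric.continuous_infDist_pt M
  obtain ⟨z, hz, hmax⟩ := hc.exists_isMaxOn hne hfc.continuousOn
  refine ⟨z, hz, ?_⟩
  have key : ∀ ε : ℝ, 0 < ε → ε < 1 →
      Metric.infDist v M + (1 - ε) * r ≤ Metric.infDist z M := by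
    intro ε hε0 hε1
    obtain ⟨y, hy, hymax⟩ := hc.exists_isMaxOn hne
      (f := fun z : E => Metric.infDist z M - (1 - ε) * dist z v)
      (by fun_prop)
    have hyv := hymax (Metric.mem_closedBall_self hr0)
    simp only [dist_self, mul_zero, sub_zero, Set.mem_ofPred_eq] at hyv
    have hyr : dist y v = r := by
      refine le_antisymm hy ?_
      by_contra! hlt
      have hd0 : 0 ≤ (1 - ε) * dist y v := mul_nonneg (by linarith) dist_nonneg
      have hyR : Metric.infDist y M < R := by
        have := Metric.infDist_le_infDist_add_dist (s := M) (x := y) (y := v)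
        linarith
      obtain ⟨a, ha, hay⟩ := hP.exists_infDist_lt hM (w := y) (by linarith) hyR hε0 hε1
        (ρ := r - dist y v) (by linarith)
      have htri := dist_triangle a y v
      have := hymax (show a ∈ Metric.closedBall v r by
        rw [Metric.mem_closedBall]; linarith)
      simp only [Set.mem_ofPred_eq] at this
      nlinarith
    have := hmax hy
    simp only [Set.mem_ofPred_eq] at this
    rw [hyr] at hyv
    linarith
  refine le_of_forall_pos_le_add fun e he => ?_
  have hε : 0 < min (1 / 2) (e / (r + 1)) := lt_min (by norm_num) (by positivity)
  have h := key _ hε (lt_of_le_of_lt (min_le_left _ _) (by norm_num))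
  have h2 : min (1 / 2) (e / (r + 1)) * (r + 1) ≤ e := by
    rw [← le_div_iff₀ (by linarith)]
    exact min_le_right _ _
  nlinarith

/-- The nearest point is unchanged when a point moves outward along its normal ray. -/
lemma IsUniqueProjection.infDist_ray (hP : IsUniqueProjection M R P) (hM : IsCompact M)
    {v : E} (hv0 : 0 < Metric.infDist v M) {r : ℝ} (hr0 : 0 ≤ r)
    (hr : Metric.infDist v M + r < R) :
    Metric.infDist v M + r ≤
      Metric.infDist (P v + ((Metric.infDist v M + r) / Metric.infDist v M) • (v - P v)) M := by
  obtain ⟨z, hzd, hz⟩ := hP.exists_infDist_eq_add hM hv0 hr0 hr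
  obtain ⟨hpM, hpd, -⟩ := hP v (by linarith)
  set f := Metric.infDist v M
  set p := P v
  have hnp : ‖v - p‖ = f := by rw [← dist_eq_norm, dist_comm, hpd]
  have hzp : f + r ≤ ‖(z - v) + (v - p)‖ := by
    rw [sub_add_sub_cancel, ← dist_eq_norm]
    exact hz.trans (Metric.infDist_le_dist_of_mem hpM)
  rw [dist_eq_norm] at hzd
  have htri := norm_add_le (z - v) (v - p)
  have hzr : ‖z - v‖ = r := by linarith
  have hray : SameRay ℝ (z - v) (v - p) := by
    rw [sameRay_iff_norm_add]
    linarith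
  have h := hray.norm_smul_eq
  rw [hzr, hnp] at h
  have hzeq : z = p + ((f + r) / f) • (v - p) := by
    have h3 : z - v = (r / f) • (v - p) := by
      rw [div_eq_inv_mul, mul_smul, h, smul_smul, inv_mul_cancel₀ hv0.ne', one_smul]
    have h4 : (f + r) / f = 1 + r / f := by field_simp
    rw [h4, add_smul, one_smul, ← h3]
    abel
  rwa [← hzeq]

/-- Proximal normal inequality. -/
lemma IsUniqueProjection.inner_le (hP : IsUniqueProjection M R P) (hM : IsCompact M)
    {v : E} (hvR : Metric.infDist v M < R) {y : E} (hy : y ∈ M) :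
    2 * R * inner ℝ (v - P v) (y - P v) ≤ Metric.infDist v M * ‖y - P v‖ ^ 2 := by
  obtain ⟨hpM, hpd, -⟩ := hP v hvR
  have hray := fun r => hP.infDist_ray hM (v := v) (r := r)
  set f := Metric.infDist v M
  set p := P v
  have hnp : ‖v - p‖ = f := by rw [← dist_eq_norm, dist_comm, hpd]
  have hf0 : 0 ≤ f := Metric.infDist_nonneg
  rcases hf0.eq_or_lt with h0 | hpos
  · rw [← h0, norm_eq_zero] at hnp
    simp [hnp, ← h0]
  have key : ∀ s, f < s → s < R → 2 * s * inner ℝ (v - p) (y - p) ≤ f * ‖y - p‖ ^ 2 := by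
    intro s hfs hsR
    have h := hray (s - f) hpos (by linarith) (by linarith)
    rw [add_sub_cancel] at h
    have h1 : s ≤ ‖(s / f) • (v - p) - (y - p)‖ := by
      rw [show (s / f) • (v - p) - (y - p) = (p + (s / f) • (v - p)) - y by abel,
        ← dist_eq_norm]
      exact h.trans (Metric.infDist_le_dist_of_mem hy)
    have hs0 : 0 < s := hpos.trans hfs
    have h2 : s ^ 2 ≤ ‖(s / f) • (v - p) - (y - p)‖ ^ 2 := by gcongr
    rw [norm_sub_sq_real, real_inner_smul_left, norm_smul, hnp, Real.norm_eq_abs,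
      abs_of_pos (div_pos hs0 hpos), div_mul_cancel₀ _ hpos.ne'] at h2
    have h3 : 2 * (s / f * inner ℝ (v - p) (y - p)) ≤ ‖y - p‖ ^ 2 := by linarith
    calc 2 * s * inner ℝ (v - p) (y - p)
        = f * (2 * (s / f * inner ℝ (v - p) (y - p))) := by field_simp
      _ ≤ f * ‖y - p‖ ^ 2 := by gcongr
  by_contra! hlt
  have hcont : Continuous fun s : ℝ => 2 * s * inner ℝ (v - p) (y - p) := by fun_prop
  have hev := (hcont.tendsto R).eventually_const_lt hlt
  have hlt' := (hev.filter_mono nhdsWithin_le_nhds).and (Ioo_mem_nhdsLT hvR)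
  obtain ⟨s, hs1, hs2, hs3⟩ := hlt'.exists
  exact (key s hs2 hs3).not_gt hs1

/-- The projection is `R / (R - s)`-Lipschitz on the closed `s`-tube. -/
lemma IsUniqueProjection.norm_sub_le (hP : IsUniqueProjection M R P) (hM : IsCompact M)
    {s : ℝ} (hs : s < R) (hR : 0 < R) {u v : E}
    (hu : Metric.infDist u M ≤ s) (hv : Metric.infDist v M ≤ s) :
    ‖P u - P v‖ ≤ R / (R - s) * ‖u - v‖ := by
  have hpM := (hP u (hu.trans_lt hs)).1
  have hqM := (hP v (hv.trans_lt hs)).1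
  have h1 := hP.inner_le hM (hu.trans_lt hs) hqM
  have h2 := hP.inner_le hM (hv.trans_lt hs) hpM
  set p := P u
  set q := P v
  rw [norm_sub_rev q p] at h1
  have h3 : inner ℝ (u - p) (q - p) + inner ℝ (v - q) (p - q)
      = ‖p - q‖ ^ 2 - inner ℝ (u - v) (p - q) := by
    rw [← real_inner_self_eq_norm_sq, ← neg_sub p q, inner_neg_right]
    simp only [inner_sub_left]
    ring
  have h4 : inner ℝ (u - v) (p - q) ≤ ‖u - v‖ * ‖p - q‖ := real_inner_le_norm _ _
  have h5 : Metric.infDist u M * ‖p - q‖ ^ 2 ≤ s * ‖p - q‖ ^ 2 := by gcongr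
  have h6 : Metric.infDist v M * ‖p - q‖ ^ 2 ≤ s * ‖p - q‖ ^ 2 := by gcongr
  have h7 : (R - s) * ‖p - q‖ ^ 2 ≤ R * (‖u - v‖ * ‖p - q‖) := by nlinarith
  have hRs : 0 < R - s := by linarith
  rcases (norm_nonneg (p - q)).eq_or_lt with h0 | hpos
  · rw [← h0]; positivity
  rw [div_mul_eq_mul_div, le_div_iff₀ hRs]
  nlinarith

end NearestPoint

section Stack

variable {n N : ℕ}

lemma stackNorm_eq_norm (z : Fin n → EuclideanSpace ℝ (Fin N)) :
    stackNorm z = ‖WithLp.toLp 2 z‖ := by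
  rw [PiLp.norm_eq_of_L2]; rfl

lemma stackNorm_add_le (y z : Fin n → EuclideanSpace ℝ (Fin N)) :
    stackNorm (fun i => y i + z i) ≤ stackNorm y + stackNorm z := by
  simp only [stackNorm_eq_norm]
  exact norm_add_le (WithLp.toLp 2 y) (WithLp.toLp 2 z)

lemma stackNorm_smul {c : ℝ} (hc : 0 ≤ c) (z : Fin n → EuclideanSpace ℝ (Fin N)) :
    stackNorm (fun i => c • z i) = c * stackNorm z := by
  simp only [stackNorm_eq_norm]
  rw [show WithLp.toLp 2 (fun i => c • z i) = c • WithLp.toLp 2 z from rfl, norm_smul,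
    Real.norm_eq_abs, abs_of_nonneg hc]

lemma norm_le_stackNorm (z : Fin n → EuclideanSpace ℝ (Fin N)) (i : Fin n) :
    ‖z i‖ ≤ stackNorm z := by
  rw [stackNorm_eq_norm]
  exact PiLp.norm_apply_le (WithLp.toLp 2 z) i

lemma stackNorm_le_mul {c : ℝ} (hc : 0 ≤ c) {y z : Fin n → EuclideanSpace ℝ (Fin N)}
    (h : ∀ i, ‖y i‖ ≤ c * ‖z i‖) : stackNorm y ≤ c * stackNorm z := by
  rw [← stackNorm_smul hc]
  refine Real.sqrt_le_sqrt (Finset.sum_le_sum fun i _ => ?_)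
  rw [norm_smul, Real.norm_eq_abs, abs_of_nonneg hc]
  gcongr
  exact h i

lemma sum_sub_mean (hn : 0 < n) (z : Fin n → EuclideanSpace ℝ (Fin N)) :
    ∑ i, (z i - (n : ℝ)⁻¹ • ∑ j, z j) = 0 := by
  have : (n : ℝ) ≠ 0 := by positivity
  rw [Finset.sum_sub_distrib, Finset.sum_const, Finset.card_univ, Fintype.card_fin,
    ← Nat.cast_smul_eq_nsmul ℝ, smul_smul, mul_inv_cancel₀ this, one_smul, sub_self]

lemma sum_norm_sub_sq_eq (hn : 0 < n) (z : Fin n → EuclideanSpace ℝ (Fin N))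
    (c : EuclideanSpace ℝ (Fin N)) :
    ∑ i, ‖z i - c‖ ^ 2 = ∑ i, ‖z i - (n : ℝ)⁻¹ • ∑ j, z j‖ ^ 2 +
      n * ‖(n : ℝ)⁻¹ • ∑ j, z j - c‖ ^ 2 := by
  have h0 := sum_sub_mean hn z
  set m := (n : ℝ)⁻¹ • ∑ j, z j
  have h : ∀ i, ‖z i - c‖ ^ 2 =
      ‖z i - m‖ ^ 2 + 2 * inner ℝ (z i - m) (m - c) + ‖m - c‖ ^ 2 := fun i => by
    rw [← norm_add_sq_real, sub_add_sub_cancel]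
  simp only [h, Finset.sum_add_distrib, ← Finset.mul_sum, ← sum_inner, h0, inner_zero_left]
  simp

lemma stackNorm_sub_le_of_norm_mean_sub_le (hn : 0 < n) (z : Fin n → EuclideanSpace ℝ (Fin N))
    {b c : EuclideanSpace ℝ (Fin N)}
    (h : ‖(n : ℝ)⁻¹ • ∑ j, z j - b‖ ≤ ‖(n : ℝ)⁻¹ • ∑ j, z j - c‖) :
    stackNorm (fun i => z i - b) ≤ stackNorm (fun i => z i - c) := by
  refine Real.sqrt_le_sqrt ?_
  rw [sum_norm_sub_sq_eq hn z b, sum_norm_sub_sq_eq hn z c]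
  gcongr

lemma stackNorm_sub_mean_le (hn : 0 < n) (z : Fin n → EuclideanSpace ℝ (Fin N))
    (c : EuclideanSpace ℝ (Fin N)) :
    stackNorm (fun i => z i - (n : ℝ)⁻¹ • ∑ j, z j) ≤ stackNorm (fun i => z i - c) :=
  stackNorm_sub_le_of_norm_mean_sub_le hn z (by simp)

lemma norm_weighted_sum_sub_le {w : Fin n → ℝ} (hw0 : ∀ j, 0 ≤ w j) (hw1 : ∑ j, w j = 1)
    {z : Fin n → EuclideanSpace ℝ (Fin N)} {c : EuclideanSpace ℝ (Fin N)} {δ : ℝ}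
    (h : ∀ j, ‖z j - c‖ ≤ δ) : ‖∑ j, w j • z j - c‖ ≤ δ := by
  rw [← mem_closedBall_iff_norm]
  exact (convex_closedBall c δ).sum_mem (fun j _ => hw0 j) hw1
    fun j _ => mem_closedBall_iff_norm.2 (h j)

lemma norm_mean_sub_le (hn : 0 < n) {z : Fin n → EuclideanSpace ℝ (Fin N)}
    {c : EuclideanSpace ℝ (Fin N)} {δ : ℝ}
    (h : ∀ j, ‖z j - c‖ ≤ δ) : ‖(n : ℝ)⁻¹ • ∑ j, z j - c‖ ≤ δ := by
  have : (n : ℝ) ≠ 0 := by positivity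
  rw [Finset.smul_sum]
  exact norm_weighted_sum_sub_le (fun _ => by positivity) (by simp [this]) h

/-- One lazy averaging step contracts the deviation from the mean. -/
lemma stackNorm_consensus_le (hn : 0 < n) {W : Matrix (Fin n) (Fin n) ℝ}
    (hrow : ∀ i, ∑ j, W i j = 1) {σ γ : ℝ}
    (hσ : ∀ z : Fin n → EuclideanSpace ℝ (Fin N), (∑ i, z i = 0) →
      stackNorm (fun i => ∑ j, W i j • z j) ≤ σ * stackNorm z)
    (hγ0 : 0 ≤ γ) (hγ1 : γ ≤ 1) (z : Fin n → EuclideanSpace ℝ (Fin N)) :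
    stackNorm (fun i => (1 - γ) • z i + γ • (∑ j, W i j • z j) - (n : ℝ)⁻¹ • ∑ j, z j) ≤
      (1 - γ * (1 - σ)) * stackNorm (fun i => z i - (n : ℝ)⁻¹ • ∑ j, z j) := by
  have hc := hσ _ (sum_sub_mean hn z)
  set m := (n : ℝ)⁻¹ • ∑ j, z j
  have heq : (fun i => (1 - γ) • z i + γ • (∑ j, W i j • z j) - m) =
      fun i => (1 - γ) • (z i - m) + γ • ∑ j, W i j • (z j - m) := by
    funext i
    simp only [smul_sub, Finset.sum_sub_distrib, ← Finset.sum_smul, hrow i, sub_smul, one_smul]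
    abel
  rw [heq]
  refine (stackNorm_add_le _ _).trans ?_
  rw [stackNorm_smul (by linarith), stackNorm_smul hγ0]
  nlinarith

end Stack

/-- One projected step keeps the stack within `δ` of consensus. -/
lemma stackNorm_step_le {n N : ℕ} (hn : 0 < n) {M : Set (EuclideanSpace ℝ (Fin N))}
    (hM : IsCompact M) {R : ℝ} (hR : 0 < R)
    {P : EuclideanSpace ℝ (Fin N) → EuclideanSpace ℝ (Fin N)} (hP : IsUniqueProjection M R P)
    {W : Matrix (Fin n) (Fin n) ℝ} (hnn : ∀ i j, 0 ≤ W i j) (hrow : ∀ i, ∑ j, W i j = 1)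
    {σ : ℝ} (hσ0 : 0 ≤ σ)
    (hσ : ∀ z : Fin n → EuclideanSpace ℝ (Fin N), (∑ i, z i = 0) →
      stackNorm (fun i => ∑ j, W i j • z j) ≤ σ * stackNorm z)
    {γ : ℝ} (hγ0 : 0 ≤ γ) (hγ1 : γ ≤ 1) {δ : ℝ} (hδR : δ < R / 4)
    {x e : Fin n → EuclideanSpace ℝ (Fin N)}
    (hc : P ((n : ℝ)⁻¹ • ∑ j, x j) ∈ M)
    (hx : stackNorm (fun i => x i - P ((n : ℝ)⁻¹ • ∑ j, x j)) ≤ δ)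
    (he1 : stackNorm e ≤ R / 4)
    (he2 : stackNorm e ≤ δ * (R * γ * (1 - σ) - δ) / (2 * (R - δ))) :
    stackNorm (fun i => P ((1 - γ) • x i + γ • (∑ j, W i j • x j) + e i) -
      P ((n : ℝ)⁻¹ • ∑ j, x j)) ≤ δ := by
  have hRδ : 0 < R - δ := by linarith
  have hcons := stackNorm_consensus_le hn hrow hσ hγ0 hγ1 x
  have hmean := (stackNorm_sub_mean_le hn x (P ((n : ℝ)⁻¹ • ∑ j, x j))).trans hx
  have hxc : ∀ j, ‖x j - P ((n : ℝ)⁻¹ • ∑ j, x j)‖ ≤ δ := fun j =>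
    (norm_le_stackNorm (fun i => x i - P ((n : ℝ)⁻¹ • ∑ j, x j)) j).trans hx
  have hm := norm_mean_sub_le hn hxc
  set m := (n : ℝ)⁻¹ • ∑ j, x j
  set c := P m
  let v : Fin n → EuclideanSpace ℝ (Fin N) := fun i => (1 - γ) • x i + γ • (∑ j, W i j • x j)
  have hvc : ∀ i, ‖v i - c‖ ≤ δ := fun i => by
    rw [← mem_closedBall_iff_norm]
    exact convex_closedBall c δ (mem_closedBall_iff_norm.2 (hxc i))
      (mem_closedBall_iff_norm.2 (norm_weighted_sum_sub_le (hnn i) (hrow i) hxc))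
      (by linarith) hγ0 (by ring)
  have hdist : ∀ {a : EuclideanSpace ℝ (Fin N)} {s : ℝ}, ‖a - c‖ ≤ s → Metric.infDist a M ≤ s :=
    fun h => (Metric.infDist_le_dist_of_mem hc).trans (by rwa [dist_eq_norm])
  have hve : ∀ i, ‖v i + e i - c‖ ≤ R / 2 := fun i => by
    rw [add_sub_right_comm]
    linarith [norm_add_le (v i - c) (e i), hvc i, norm_le_stackNorm e i]
  have hA : stackNorm (fun i => P (v i + e i) - P (v i)) ≤ 2 * stackNorm e := by
    refine stackNorm_le_mul (by norm_num) fun i => ?_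
    have := hP.norm_sub_le hM (s := R / 2) (by linarith) hR (hdist (hve i))
      ((hdist (hvc i)).trans (by linarith))
    rwa [add_sub_cancel_left, show R / (R - R / 2) = 2 by field_simp; norm_num] at this
  have hB : stackNorm (fun i => P (v i) - c) ≤ R / (R - δ) * stackNorm (fun i => v i - m) :=
    stackNorm_le_mul (by positivity) fun i =>
      hP.norm_sub_le hM (by linarith) hR (hdist (hvc i)) (hdist hm)
  have hAB := stackNorm_add_le (fun i => P (v i + e i) - P (v i)) (fun i => P (v i) - c)
  simp only [sub_add_sub_cancel] at hAB
  have hρ : 0 ≤ 1 - γ * (1 - σ) := by nlinarith [mul_nonneg hγ0 hσ0]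
  have hV : stackNorm (fun i => v i - m) ≤ (1 - γ * (1 - σ)) * δ := hcons.trans (by gcongr)
  calc stackNorm (fun i => P (v i + e i) - c)
      ≤ 2 * stackNorm e + R / (R - δ) * stackNorm (fun i => v i - m) := by linarith
    _ ≤ 2 * (δ * (R * γ * (1 - σ) - δ) / (2 * (R - δ))) +
        R / (R - δ) * ((1 - γ * (1 - σ)) * δ) := by gcongr
    _ = δ := by field_simp; ring


/-- staying in neighborhood, projected gradient, single-step consensus:
Let `M ⊆ ℝ^{d×r}` (modeled as a Euclidean space) be a compact `R`-proximally smooth set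
with nearest-point projection `P`, `W` symmetric doubly stochastic with second largest
singular value `σ₂ < 1`, and `γ ∈ (0,1]`. Consider the iteration
`x_{i,k+1} = P((1-γ) x_{i,k} + γ ∑_j W_{ij} x_{j,k} + η d_{i,k})`.
If `‖x_0 - x̄_0‖ ≤ δ` with `δ < min{Rγ(1-σ₂), R/4}`, and
`‖η d_k‖ ≤ min{R/4, δ(Rγ(1-σ₂) - δ)/(2(R-δ))}` at every step, then
`‖x_k - x̄_k‖ ≤ δ` for all `k`, where `x̄_k = P(x̂_k)` stacked, `x̂_k` the Euclidean
average. -/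
theorem stmt10 {n N : ℕ} (hn : 0 < n)
    (M : Set (EuclideanSpace ℝ (Fin N))) (hMcompact : IsCompact M) (hMne : M.Nonempty)
    (R : ℝ) (hR : 0 < R)
    (P : EuclideanSpace ℝ (Fin N) → EuclideanSpace ℝ (Fin N))
    (hP : ∀ z, Metric.infDist z M < R →
      P z ∈ M ∧ dist (P z) z = Metric.infDist z M ∧
        ∀ y ∈ M, dist y z = Metric.infDist z M → y = P z)
    (W : Matrix (Fin n) (Fin n) ℝ) (hsymm : W.IsSymm) (hnn : ∀ i j, 0 ≤ W i j)
    (hrow : ∀ i, ∑ j, W i j = 1)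
    (σ₂ : ℝ) (hσ₂0 : 0 ≤ σ₂) (hσ₂1 : σ₂ < 1)
    (hσ : ∀ z : Fin n → EuclideanSpace ℝ (Fin N), (∑ i, z i = 0) →
      stackNorm (fun i => ∑ j, W i j • z j) ≤ σ₂ * stackNorm z)
    (γ : ℝ) (hγ0 : 0 < γ) (hγ1 : γ ≤ 1) (η : ℝ) (hη : 0 < η)
    (δ : ℝ) (hδ0 : 0 < δ) (hδ : δ < min (R * γ * (1 - σ₂)) (R / 4))
    (x d : ℕ → Fin n → EuclideanSpace ℝ (Fin N))
    (hx0mem : ∀ i, x 0 i ∈ M)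
    (hiter : ∀ k i, x (k + 1) i =
      P ((1 - γ) • x k i + γ • (∑ j, W i j • x k j) + η • d k i))
    (hinit : stackNorm (fun i => x 0 i - P ((n : ℝ)⁻¹ • ∑ j, x 0 j)) ≤ δ)
    (hd : ∀ k, stackNorm (fun i => η • d k i) ≤
      min (R / 4) (δ * (R * γ * (1 - σ₂) - δ) / (2 * (R - δ)))) :
    ∀ k, stackNorm (fun i => x k i - P ((n : ℝ)⁻¹ • ∑ j, x k j)) ≤ δ := by
  obtain ⟨-, hδR⟩ := lt_min_iff.1 hδ
  have hPu : IsUniqueProjection M R P := hP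
  have htube : ∀ (z : Fin n → EuclideanSpace ℝ (Fin N)) (c : EuclideanSpace ℝ (Fin N)),
      c ∈ M → stackNorm (fun i => z i - c) ≤ δ →
        Metric.infDist ((n : ℝ)⁻¹ • ∑ j, z j) M < R := by
    intro z c hcM hz
    have h := norm_mean_sub_le hn fun j => (norm_le_stackNorm (fun i => z i - c) j).trans hz
    refine (Metric.infDist_le_dist_of_mem hcM).trans_lt ?_
    rw [dist_eq_norm]
    linarith
  have main : ∀ k, P ((n : ℝ)⁻¹ • ∑ j, x k j) ∈ M ∧
      stackNorm (fun i => x k i - P ((n : ℝ)⁻¹ • ∑ j, x k j)) ≤ δ := by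
    intro k
    induction k with
    | zero =>
      refine ⟨(hP _ ?_).1, hinit⟩
      have hj := fun j => (norm_le_stackNorm
        (fun i => x 0 i - P ((n : ℝ)⁻¹ • ∑ j, x 0 j)) j).trans hinit
      have hmean := norm_mean_sub_le hn hj
      refine (Metric.infDist_le_dist_of_mem (hx0mem ⟨0, hn⟩)).trans_lt ?_
      have htri := dist_triangle_right ((n : ℝ)⁻¹ • ∑ j, x 0 j) (x 0 ⟨0, hn⟩)
        (P ((n : ℝ)⁻¹ • ∑ j, x 0 j))
      have h0 := hj ⟨0, hn⟩
      rw [← dist_eq_norm] at hmean h0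
      linarith
    | succ k ih =>
      obtain ⟨hcM, hck⟩ := ih
      obtain ⟨hd1, hd2⟩ := le_min_iff.1 (hd k)
      have hstep := stackNorm_step_le hn hMcompact hR hPu hnn hrow hσ₂0 hσ hγ0.le hγ1
        hδR hcM hck hd1 hd2
      simp only [← hiter] at hstep
      obtain ⟨hqM, hqd, -⟩ := hP _ (htube _ _ hcM hstep)
      refine ⟨hqM, (stackNorm_sub_le_of_norm_mean_sub_le hn (x (k + 1)) ?_).trans hstep⟩
      rw [← dist_eq_norm, ← dist_eq_norm, dist_comm, hqd]
      exact Metric.infDist_le_dist_of_mem hcM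
  exact fun k => (main k).2
end
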